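/- arXiv:1212.1293 — 3 statements merged into one kernel-verified Lean document; each statement's English description precedes it below -/
import Mathlib

section
/- Let n ≥ 1 and Ω > 0. For each ω ≥ Ω let p(ω) ∈ ℂ[X] be a monic polynomial of degree 2n with ∫_{−1}^{1} p(ω)(x)·x^k·e^{iωx} dx = 0 for k = 0,…,2n−1, with coefficients uniformly bounded in ω, and with pairwise distinct roots y_1(ω),…,y_{2n}(ω) satisfying a separation condition |y_i(ω) − y_j(ω)| ≥ c/ω (i ≠ j) for some c > 0. Assume an n-point Gauss–Laguerre rule exists (pairwise distinct positive ξ_1,…,ξ_n and real η_1,…,η_n exact on polynomials of degree ≤ 2n−1 for the weight e^{−t} on [0,∞)). For each ω ≥ Ω let w_1(ω),…,w_{2n}(ω) ∈ ℂ be Gaussian weights satisfying Σ_{j=1}^{2n} w_j(ω)·y_j(ω)^k = ∫_{−1}^{1} x^k·e^{iωx} dx for every k = 0,…,4n−1. Then for every entire function f : ℂ → ℂ there exists C such that |Σ_{j=1}^{2n} w_j(ω)·f(y_j(ω)) − ∫_{−1}^{1} f(x)·e^{iωx} dx| ≤ C·ω^{−2n−1} for all ω ≥ Ω; that is, the 2n-point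 Gaussian rule for the weight e^{iωx} on [−1,1] has quadrature error O(ω^{−2n−1}) as ω → ∞. -/
open Polynomial MeasureTheory
open Filter Topology

noncomputable def Lam : ℂ[X] →ₗ[ℂ] ℂ :=
  Polynomial.lsum (fun k => (Nat.factorial k : ℂ) • LinearMap.id)

lemma Lam_eq (P : ℂ[X]) (N : ℕ) (h : P.natDegree ≤ N) :
    Lam P = ∑ k ∈ Finset.range (N+1), (Nat.factorial k : ℂ) * P.coeff k := by
  unfold Lam
  rw [Polynomial.lsum_apply, Polynomial.sum_over_range' _ (by simp) (N+1) (by omega)]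
  simp

lemma Lam_monomial (k : ℕ) (a : ℂ) : Lam (monomial k a) = (Nat.factorial k : ℂ) * a := by
  unfold Lam
  rw [Polynomial.lsum_apply, Polynomial.sum_monomial_index _ _ (by simp)]
  simp

lemma Lam_deriv (P : ℂ[X]) : Lam P = P.eval 0 + Lam (derivative P) := by
  induction P using Polynomial.induction_on' with
  | add p q hp hq => rw [map_add, hp, hq]; simp; ring
  | monomial k a =>
    rw [derivative_monomial, Lam_monomial, Lam_monomial]
    cases k with
    | zero => simp
    | succ k => simp [Nat.factorial_succ, eval_monomial]; ring

lemma Lam_C_mul (a : ℂ) (P : ℂ[X]) : Lam (C a * P) = a * Lam P := by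
  rw [← smul_eq_C_mul, map_smul, smul_eq_mul]

lemma Lam_integral (P : ℂ[X]) :
    IntegrableOn (fun t : ℝ => P.eval (t:ℂ) * (Real.exp (-t) : ℂ)) (Set.Ioi 0) ∧
    ∫ t in Set.Ioi (0:ℝ), P.eval (t:ℂ) * (Real.exp (-t) : ℂ) = Lam P := by
  induction P using Polynomial.induction_on' with
  | add p q hp hq =>
    constructor
    · have := hp.1.add hq.1
      refine this.congr (Eventually.of_forall fun t => ?_)
      simp [add_mul]
    · rw [map_add, ← hp.2, ← hq.2, ← integral_add hp.1 hq.1]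
      simp [add_mul]
  | monomial k a =>
    have h1 := Real.GammaIntegral_convergent (s := k+1) (by positivity)
    have h2 := Real.Gamma_eq_integral (s := k+1) (by positivity)
    rw [Real.Gamma_nat_eq_factorial] at h2
    have e : ∀ t : ℝ, (monomial k a).eval (t:ℂ) * (Real.exp (-t) : ℂ)
        = a * ((Real.exp (-t) * t ^ ((k:ℝ)+1-1) : ℝ) : ℂ) := by
      intro t; simp; ring
    simp_rw [e]
    constructor
    · exact (h1.ofReal).const_mul a
    · rw [integral_const_mul, Lam_monomial, integral_complex_ofReal, ← h2]
      push_cast; ring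

/-- positivity -/
lemma Lam_pos {ι : Type*} (S : Finset ι) (ν : ι → ℂ) :
    Lam (∏ j ∈ S, ((C (ν j) + C Complex.I * X) * (C (-(starRingEnd ℂ (ν j))) + C Complex.I * X))) ≠ 0 := by
  intro h
  rw [← (Lam_integral _).2] at h
  have e : ∀ t : ℝ, (∏ j ∈ S, ((C (ν j) + C Complex.I * X) * (C (-(starRingEnd ℂ (ν j))) + C Complex.I * X))).eval (t:ℂ) * (Real.exp (-t) : ℂ)
     = (-1)^S.card * (((∏ j ∈ S, ‖ν j + Complex.I * t‖^2) * Real.exp (-t) : ℝ) : ℂ) := by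
    intro t
    rw [eval_prod]
    push_cast
    rw [← mul_assoc, ← Finset.prod_const, ← Finset.prod_mul_distrib]
    congr 1
    refine Finset.prod_congr rfl fun j _ => ?_
    rw [← Complex.mul_conj']
    simp
    ring
  simp_rw [e] at h
  rw [integral_const_mul, integral_complex_ofReal] at h
  have h' : ∫ t in Set.Ioi (0:ℝ), (∏ j ∈ S, ‖ν j + Complex.I * t‖^2) * Real.exp (-t) = 0 := by
    rcases mul_eq_zero.1 h with h | h
    · simp at h
    · exact_mod_cast h
  have hint : IntegrableOn (fun t : ℝ => (∏ j ∈ S, ‖ν j + Complex.I * t‖^2) * Real.exp (-t)) (Set.Ioi 0) := by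
    have := (Lam_integral (∏ j ∈ S, ((C (ν j) + C Complex.I * X) * (C (-(starRingEnd ℂ (ν j))) + C Complex.I * X)))).1
    refine this.norm.congr ?_
    refine Eventually.of_forall fun t => ?_
    simp only [e]
    rw [norm_mul, Complex.norm_real]
    simp
  rw [integral_eq_zero_iff_of_nonneg (fun t => by positivity) hint] at h'
  have h3 := Measure.eqOn_open_of_ae_eq h' isOpen_Ioi (by fun_prop) (by fun_prop)
  let P : ℂ[X] := ∏ j ∈ S, (C (ν j) + C Complex.I * X)
  have hP : P = 0 := by
    apply Polynomial.eq_zero_of_infinite_isRoot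
    have hi : ((fun t : ℝ => (t:ℂ)) '' Set.Ioi (0:ℝ)).Infinite :=
      (Set.Ioi_infinite 0).image (Complex.ofReal_injective.injOn)
    refine hi.mono ?_
    rintro _ ⟨t, ht, rfl⟩
    have := h3 ht
    simp only [Pi.zero_apply, mul_eq_zero, (Real.exp_pos _).ne', or_false] at this
    rw [Finset.prod_eq_zero_iff] at this
    obtain ⟨j, hj, hj2⟩ := this
    simp only [Set.mem_ofPred_eq, IsRoot, P, eval_prod]
    refine Finset.prod_eq_zero hj ?_
    simpa using hj2
  rw [Finset.prod_eq_zero_iff] at hP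
  obtain ⟨j, _, hj⟩ := hP
  have := congrArg (fun p => p.coeff 1) hj
  simp [coeff_C] at this

/-- coefficientwise convergence -/
def PT (l : Filter ℝ) (G : ℝ → ℂ[X]) (G0 : ℂ[X]) : Prop :=
  (∃ N, ∀ ω, (G ω).natDegree ≤ N) ∧
    ∀ k, Tendsto (fun ω => (G ω).coeff k) l (𝓝 (G0.coeff k))

lemma PT.mul {l G G0 H H0} (hG : PT l G G0) (hH : PT l H H0) :
    PT l (fun ω => G ω * H ω) (G0 * H0) := by
  obtain ⟨⟨N, hN⟩, h1⟩ := hG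
  obtain ⟨⟨M, hM⟩, h2⟩ := hH
  refine ⟨⟨N+M, fun ω => natDegree_mul_le.trans (add_le_add (hN ω) (hM ω))⟩, fun k => ?_⟩
  simp_rw [coeff_mul]
  exact tendsto_finsetSum _ fun i _ => (h1 _).mul (h2 _)

lemma PT.const (l P) : PT l (fun _ => P) P :=
  ⟨⟨_, fun _ => le_rfl⟩, fun _ => tendsto_const_nhds⟩

lemma PT.prod {ι : Type*} {l} (s : Finset ι) {G : ι → ℝ → ℂ[X]} {G0 : ι → ℂ[X]}
    (h : ∀ j ∈ s, PT l (G j) (G0 j)) :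
    PT l (fun ω => ∏ j ∈ s, G j ω) (∏ j ∈ s, G0 j) := by
  classical
  induction s using Finset.induction_on with
  | empty => simpa using PT.const l 1
  | insert a s ha ih =>
    simp_rw [Finset.prod_insert ha]
    exact (h a (by simp)).mul (ih fun j hj => h j (by simp [hj]))

lemma PT.linear {l : Filter ℝ} {a b : ℝ → ℂ} {a0 b0 : ℂ} (ha : Tendsto a l (𝓝 a0)) (hb : Tendsto b l (𝓝 b0)) :
    PT l (fun ω => C (a ω) + C (b ω) * X) (C a0 + C b0 * X) := by
  refine ⟨⟨1, fun ω => natDegree_add_le_of_degree_le (by simp) ((natDegree_C_mul_le _ _).trans natDegree_X_le)⟩, fun k => ?_⟩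
  rcases k with _ | _ | k
  · simpa using ha
  · simpa [coeff_C] using hb
  · simp only [coeff_add, coeff_C_mul, coeff_C, coeff_X]
    simpa using tendsto_const_nhds

lemma PT.lam {l G G0} (hG : PT l G G0) : Tendsto (fun ω => Lam (G ω)) l (𝓝 (Lam G0)) := by
  obtain ⟨⟨N, hN⟩, h1⟩ := hG
  have e : ∀ ω, Lam (G ω) = ∑ k ∈ Finset.range (max N G0.natDegree+1), (Nat.factorial k : ℂ) * (G ω).coeff k :=
    fun ω => Lam_eq _ _ ((hN ω).trans (le_max_left _ _))
  simp_rw [e]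
  rw [Lam_eq G0 _ (le_max_right N _)]
  exact tendsto_finsetSum _ fun i _ => (h1 _).const_mul _

/-- endpoint functional -/
noncomputable def EL (ω : ℝ) (c : ℂ) (F : ℂ[X]) : ℂ :=
  Lam (F.comp (C c + C (Complex.I / ω) * X))

lemma EL_deriv (ω : ℝ) (c : ℂ) (F : ℂ[X]) :
    EL ω c F = F.eval c + (Complex.I / ω) * EL ω c (derivative F) := by
  unfold EL
  rw [Lam_deriv, derivative_comp, ← Lam_C_mul]
  simp

/-- integration by parts -/
lemma ibp (ω : ℝ) (hω : 0 < ω) (g g' : ℝ → ℂ) (hg : ∀ x, HasDerivAt g (g' x) x) (hc : Continuous g') :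
    ∫ x in (-1:ℝ)..1, g x * Complex.exp (Complex.I * ω * x) =
      (1 / (Complex.I * ω)) * (g 1 * Complex.exp (Complex.I * ω) - g (-1) * Complex.exp (- (Complex.I * ω))
        - ∫ x in (-1:ℝ)..1, g' x * Complex.exp (Complex.I * ω * x)) := by
  have hne : Complex.I * ω ≠ 0 := by simp [hω.ne']
  have hv : ∀ x : ℝ, HasDerivAt (fun x : ℝ => Complex.exp (Complex.I * ω * x) / (Complex.I * ω))
      (Complex.exp (Complex.I * ω * x)) x := by
    intro x
    have h1 : HasDerivAt (fun x : ℝ => Complex.I * ω * (x:ℂ)) (Complex.I * ω) x := by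
      simpa using (Complex.ofRealCLM.hasDerivAt (x := x)).const_mul (Complex.I * ω)
    have := (h1.cexp).div_const (Complex.I * ω)
    rwa [mul_div_cancel_right₀ _ hne] at this
  have := intervalIntegral.integral_mul_deriv_eq_deriv_mul (a := -1) (b := 1)
    (fun x _ => hg x) (fun x _ => hv x)
    (hc.intervalIntegrable _ _) ((by fun_prop : Continuous fun x : ℝ => Complex.exp (Complex.I * ω * x)).intervalIntegrable _ _)
  rw [this]
  have e : ∀ x : ℝ, g' x * (Complex.exp (Complex.I * ω * x) / (Complex.I * ω)) =
     (1 / (Complex.I * ω)) * (g' x * Complex.exp (Complex.I * ω * x)) := by intro x; ring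
  simp_rw [e]
  rw [intervalIntegral.integral_const_mul]
  push_cast
  rw [mul_one, mul_neg, mul_one]
  ring

lemma I_eq (ω : ℝ) (hω : 0 < ω) (N : ℕ) : ∀ (F : ℂ[X]), F.natDegree ≤ N →
    ∫ x in (-1:ℝ)..1, F.eval (x:ℂ) * Complex.exp (Complex.I * ω * x) =
      (1 / (Complex.I * ω)) * (Complex.exp (Complex.I * ω) * EL ω 1 F -
        Complex.exp (-(Complex.I * ω)) * EL ω (-1) F) := by
  have hd : ∀ F : ℂ[X], ∀ x : ℝ, HasDerivAt (fun x : ℝ => F.eval (x:ℂ)) ((derivative F).eval (x:ℂ)) x :=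
    fun F x => (F.hasDerivAt (x:ℂ)).comp_ofReal
  have hω' : (ω:ℂ) ≠ 0 := by exact_mod_cast hω.ne'
  have hI : Complex.I / ω = - (1 / (Complex.I * ω)) := by
    field_simp; simp
  induction N with
  | zero =>
    intro F hF
    rw [ibp ω hω _ _ (hd F) (by fun_prop), EL_deriv ω 1, EL_deriv ω (-1), derivative_of_natDegree_zero (by omega)]
    simp only [EL, zero_comp, map_zero, mul_zero, add_zero, eval_zero, zero_mul, intervalIntegral.integral_zero]
    push_cast; ring
  | succ N ih =>
    intro F hF
    rw [ibp ω hω _ _ (hd F) (by fun_prop), EL_deriv ω 1, EL_deriv ω (-1), ih (derivative F) (by have := natDegree_derivative_le F; omega), hI]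
    push_cast; ring

noncomputable def sc {N : ℕ} (y : ℝ → Fin N → ℂ) (S : Finset (Fin N)) (c : ℂ) (ω : ℝ) (j : Fin N) : ℂ :=
  if j ∈ S then (ω:ℂ)⁻¹ else c - y ω j

lemma comp_scale {ι : Type*} (s : Finset ι) (z lam : ι → ℂ) (c θ : ℂ) (h : ∀ j ∈ s, lam j ≠ 0) :
    (∏ j ∈ s, (X - C (z j))).comp (C c + C θ * X) =
      C (∏ j ∈ s, lam j) * ∏ j ∈ s, (C ((c - z j) / lam j) + C (θ / lam j) * X) := by
  rw [prod_comp, map_prod, ← Finset.prod_mul_distrib]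
  refine Finset.prod_congr rfl fun j hj => ?_
  have := h j hj
  rw [mul_add, ← mul_assoc, ← C_mul, ← C_mul, mul_div_cancel₀ _ this, mul_div_cancel₀ _ this]
  simp; ring

lemma tendsto_theta {l : Filter ℝ} (hl : l ≤ atTop) : Tendsto (fun ω : ℝ => Complex.I / (ω:ℂ)) l (𝓝 0) := by
  rw [tendsto_zero_iff_norm_tendsto_zero]
  have : Tendsto (fun ω : ℝ => ‖ω‖⁻¹) l (𝓝 0) :=
    (tendsto_norm_atTop_atTop.mono_left hl).inv_tendsto_atTop
  simpa using this

lemma PT_main {N : ℕ} {l : Filter ℝ} (hl : l ≤ atTop) (y : ℝ → Fin N → ℂ) (c : ℂ)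
    (S : Finset (Fin N)) (ν : Fin N → ℂ)
    (hS : ∀ j ∈ S, Tendsto (fun ω : ℝ => (ω:ℂ) * (c - y ω j)) l (𝓝 (ν j)))
    (hS2 : ∀ j ∉ S, Tendsto (fun ω : ℝ => ‖(ω:ℂ) * (c - y ω j)‖) l atTop) :
    (∀ᶠ ω in l, ∀ j, sc y S c ω j ≠ 0) ∧
    PT l (fun ω => ∏ j, (C ((c - y ω j) / sc y S c ω j) + C ((Complex.I / ω) / sc y S c ω j) * X))
      (∏ j, (if j ∈ S then C (ν j) + C Complex.I * X else 1)) := by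
  have hpos : ∀ᶠ ω in l, (0:ℝ) < ω := hl (eventually_gt_atTop 0)
  have hne : ∀ j, ∀ᶠ ω in l, sc y S c ω j ≠ 0 := by
    intro j
    by_cases hj : j ∈ S
    · filter_upwards [hpos] with ω hω
      simp [sc, hj, hω.ne']
    · filter_upwards [(hS2 j hj).eventually_gt_atTop 0] with ω h2
      simp only [sc, hj, if_false]
      intro h; simp [h] at h2
  refine ⟨eventually_all.2 hne, PT.prod _ fun j _ => ?_⟩
  by_cases hj : j ∈ S
  · simp only [hj, if_true]
    refine PT.linear ?_ ?_
    · refine (hS j hj).congr fun ω => ?_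
      simp [sc, hj]; ring
    · refine tendsto_const_nhds.congr' ?_
      filter_upwards [hpos] with ω hω
      have : (ω:ℂ) ≠ 0 := by exact_mod_cast hω.ne'
      simp [sc, hj]; field_simp
  · simp only [hj, if_false]
    have : (1 : ℂ[X]) = C 1 + C 0 * X := by simp
    rw [this]
    refine PT.linear ?_ ?_
    · refine tendsto_const_nhds.congr' ?_
      filter_upwards [hne j] with ω h
      simp only [sc, hj, if_false] at h ⊢
      rw [div_self h]
    · rw [tendsto_zero_iff_norm_tendsto_zero]
      refine (hS2 j hj).inv_tendsto_atTop.congr fun ω => ?_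
      simp [sc, hj, div_eq_mul_inv, mul_comm]

set_option maxHeartbeats 1000000 in
lemma one_sided {N : ℕ} {l : Filter ℝ} [l.NeBot] (hl : l ≤ atTop) (y : ℝ → Fin N → ℂ) (c : ℂ)
    (hc : c = 1 ∨ c = -1)
    (S S' : Finset (Fin N)) (ν ν' : Fin N → ℂ)
    (hS : ∀ j ∈ S, Tendsto (fun ω : ℝ => (ω:ℂ) * (c - y ω j)) l (𝓝 (ν j)))
    (hS2 : ∀ j ∉ S, Tendsto (fun ω : ℝ => ‖(ω:ℂ) * (c - y ω j)‖) l atTop)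
    (hS' : ∀ j ∈ S', Tendsto (fun ω : ℝ => (ω:ℂ) * (-c - y ω j)) l (𝓝 (ν' j)))
    (hS2' : ∀ j ∉ S', Tendsto (fun ω : ℝ => ‖(ω:ℂ) * (-c - y ω j)‖) l atTop)
    (s : ℕ) (hs : S.card + s + 1 = N)
    (hEL : ∀ᶠ ω in l, ∀ q : ℂ[X], q.natDegree < N →
      ‖EL ω c ((∏ j, (X - C (y ω j))) * q)‖ = ‖EL ω (-c) ((∏ j, (X - C (y ω j))) * q)‖) :
    ∃ K, 0 < K ∧ ∀ᶠ ω in l, (∏ j, ‖sc y S c ω j‖) * ω ^ s ≤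
      K * (∏ j, ‖sc y S' (-c) ω j‖) * ω ^ S.card := by
  have hpos : ∀ᶠ ω in l, (0:ℝ) < ω := hl (eventually_gt_atTop 0)
  obtain ⟨hn1, hP1⟩ := PT_main hl y c S ν hS hS2
  obtain ⟨hn2, hP2⟩ := PT_main hl y (-c) S' ν' hS' hS2'
  have hcc : starRingEnd ℂ c = c := by rcases hc with rfl | rfl <;> simp
  have hc0 : c ≠ 0 := by rcases hc with rfl | rfl <;> simp
  have hy : ∀ j ∈ S, Tendsto (fun ω => y ω j) l (𝓝 c) := by
    intro j hj
    have h1 := ((hS j hj).mul (tendsto_theta hl)).mul_const (-Complex.I)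
    have h2 : Tendsto (fun ω => c - y ω j) l (𝓝 0) := by
      simp only [mul_zero, zero_mul] at h1
      refine h1.congr' ?_
      filter_upwards [hpos] with ω hω
      have : (ω:ℂ) ≠ 0 := by exact_mod_cast hω.ne'
      field_simp
      rw [Complex.I_sq]; ring
    simpa using h2.const_sub c
  let zz : ℝ → Fin N → ℂ := fun ω j => 2 * c - starRingEnd ℂ (y ω j)
  have hQ1 : PT l (fun ω => ∏ j ∈ S, (C ((c - zz ω j) / (ω:ℂ)⁻¹) + C ((Complex.I / ω) / (ω:ℂ)⁻¹) * X))
      (∏ j ∈ S, (C (-(starRingEnd ℂ (ν j))) + C Complex.I * X)) := by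
    refine PT.prod _ fun j hj => PT.linear ?_ ?_
    · refine (((Complex.continuous_conj.tendsto _).comp (hS j hj)).neg).congr fun ω => ?_
      simp [zz, hcc]; ring
    · refine tendsto_const_nhds.congr' ?_
      filter_upwards [hpos] with ω hω
      have : (ω:ℂ) ≠ 0 := by exact_mod_cast hω.ne'
      field_simp
  have hQ2 : PT l (fun ω => ∏ j ∈ S, (C ((-c - zz ω j) / 1) + C ((Complex.I / ω) / 1) * X))
      (∏ j ∈ S, (C (-3 * c + c) + C 0 * X)) := by
    refine PT.prod _ fun j hj => PT.linear ?_ ?_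
    · have := ((Complex.continuous_conj.tendsto _).comp (hy j hj)).const_add (-3 * c)
      rw [hcc] at this
      refine this.congr fun ω => ?_
      simp [zz]; ring
    · simpa using tendsto_theta hl
  have hR1 : PT l (fun ω => ∏ _j ∈ Finset.range s, (C ((c - (-c)) / 1) + C ((Complex.I / ω) / 1) * X))
      (∏ _j ∈ Finset.range s, (C (2 * c) + C 0 * X)) := by
    refine PT.prod _ fun j hj => PT.linear ?_ ?_
    · refine tendsto_const_nhds.congr fun ω => ?_
      ring
    · simpa using tendsto_theta hl
  have hR2 : PT l (fun ω => ∏ _j ∈ Finset.range s, (C ((-c - (-c)) / (ω:ℂ)⁻¹) + C ((Complex.I / ω) / (ω:ℂ)⁻¹) * X))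
      (∏ _j ∈ Finset.range s, (C 0 + C Complex.I * X)) := by
    refine PT.prod _ fun j hj => PT.linear ?_ ?_
    · simpa using tendsto_const_nhds
    · refine tendsto_const_nhds.congr' ?_
      filter_upwards [hpos] with ω hω
      have : (ω:ℂ) ≠ 0 := by exact_mod_cast hω.ne'
      field_simp
  have T1 := ((hP1.mul hQ1).mul hR1).lam
  have T2 := ((hP2.mul hQ2).mul hR2).lam
  obtain ⟨L1, hL1⟩ : ∃ L1, L1 = Lam ((∏ j, (if j ∈ S then C (ν j) + C Complex.I * X else 1)) *
      (∏ j ∈ S, (C (-(starRingEnd ℂ (ν j))) + C Complex.I * X)) * (∏ _j ∈ Finset.range s, (C (2 * c) + C 0 * X))) := ⟨_, rfl⟩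
  rw [← hL1] at T1
  have hL1ne : L1 ≠ 0 := by
    have e : ((∏ j, (if j ∈ S then C (ν j) + C Complex.I * X else 1)) *
      (∏ j ∈ S, (C (-(starRingEnd ℂ (ν j))) + C Complex.I * X)) * (∏ _j ∈ Finset.range s, (C (2 * c) + C 0 * X))) =
       C ((2*c)^s) * ∏ j ∈ S, ((C (ν j) + C Complex.I * X) * (C (-(starRingEnd ℂ (ν j))) + C Complex.I * X)) := by
      rw [Finset.prod_ite_mem, Finset.univ_inter, ← Finset.prod_mul_distrib, Finset.prod_const, Finset.card_range]
      simp only [C_0, zero_mul, add_zero, C_pow]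
      ring
    rw [hL1, e, Lam_C_mul]
    exact mul_ne_zero (pow_ne_zero _ (mul_ne_zero two_ne_zero hc0)) (Lam_pos S ν)
  obtain ⟨L2, hL2⟩ : ∃ L2, L2 = ‖Lam ((∏ j, (if j ∈ S' then C (ν' j) + C Complex.I * X else 1)) *
      (∏ j ∈ S, (C (-3 * c + c) + C 0 * X)) * (∏ _j ∈ Finset.range s, (C 0 + C Complex.I * X)))‖ := ⟨_, rfl⟩
  have T2' := T2.norm
  rw [← hL2] at T2'
  have hlow := (T1.norm).eventually_const_lt (u := ‖L1‖ / 2) (by have := norm_pos_iff.2 hL1ne; linarith)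
  have hup := T2'.eventually_lt_const (lt_add_one _)
  have hL1p : 0 < ‖L1‖ := norm_pos_iff.2 hL1ne
  have hL2p : 0 ≤ L2 := hL2 ▸ norm_nonneg _
  refine ⟨(L2 + 1) / (‖L1‖ / 2), by positivity, ?_⟩
  filter_upwards [hpos, hn1, hn2, hlow, hup, hEL] with ω hω h1 h2 hlow hup hEL
  have hω' : (ω:ℂ)⁻¹ ≠ 0 := by simp [hω.ne']
  have key := hEL ((∏ j ∈ S, (X - C (zz ω j))) * ∏ _j ∈ Finset.range s, (X - C (-c))) (by
    rw [Finset.prod_const, Finset.card_range]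
    refine lt_of_le_of_lt natDegree_mul_le ?_
    rw [(monic_X_sub_C _).natDegree_pow, natDegree_prod_of_monic _ _ (fun j _ => monic_X_sub_C _)]
    simp; omega)
  unfold EL at key
  rw [mul_comp, mul_comp, mul_comp, mul_comp,
    comp_scale Finset.univ (y ω) (sc y S c ω) c (Complex.I / ω) (fun j _ => h1 j),
    comp_scale Finset.univ (y ω) (sc y S' (-c) ω) (-c) (Complex.I / ω) (fun j _ => h2 j),
    comp_scale S (zz ω) (fun _ => (ω:ℂ)⁻¹) c (Complex.I / ω) (fun j _ => hω'),
    comp_scale S (zz ω) (fun _ => 1) (-c) (Complex.I / ω) (fun j _ => one_ne_zero),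
    comp_scale (Finset.range s) (fun _ => -c) (fun _ => 1) c (Complex.I / ω) (fun j _ => one_ne_zero),
    comp_scale (Finset.range s) (fun _ => -c) (fun _ => (ω:ℂ)⁻¹) (-c) (Complex.I / ω) (fun j _ => hω')] at key
  have r : ∀ (a b d : ℂ) (A B D : ℂ[X]), (C a * A) * ((C b * B) * (C d * D)) = C (a * b * d) * (A * B * D) := by
    intros; simp only [C_mul]; ring
  rw [r, r, Lam_C_mul, Lam_C_mul, norm_mul, norm_mul] at key
  simp only [Finset.prod_const, Finset.card_range, one_pow, mul_one, norm_mul, norm_pow, norm_inv, norm_prod, norm_one,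
    Complex.norm_real, Real.norm_eq_abs, abs_of_pos hω] at key
  simp only [Finset.prod_const, Finset.card_range] at hlow hup
  set A := ∏ j, ‖sc y S c ω j‖
  set B := ∏ j, ‖sc y S' (-c) ω j‖
  have hA : 0 ≤ A := Finset.prod_nonneg fun _ _ => norm_nonneg _
  have hB : 0 ≤ B := Finset.prod_nonneg fun _ _ => norm_nonneg _
  have i1 : A * ω⁻¹ ^ S.card * (‖L1‖ / 2) ≤ B * ω⁻¹ ^ s * (L2 + 1) := by
    refine (mul_le_mul_of_nonneg_left hlow.le (by positivity)).trans ?_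
    rw [key]
    exact mul_le_mul_of_nonneg_left hup.le (by positivity)
  have i2 := mul_le_mul_of_nonneg_right i1 (by positivity : 0 ≤ ω ^ s * ω ^ S.card)
  have e1 : ω⁻¹ ^ S.card * ω ^ S.card = 1 := by rw [← mul_pow, inv_mul_cancel₀ hω.ne', one_pow]
  have e2 : ω⁻¹ ^ s * ω ^ s = 1 := by rw [← mul_pow, inv_mul_cancel₀ hω.ne', one_pow]
  have i3 : A * ω ^ s * (‖L1‖ / 2) ≤ (L2 + 1) * B * ω ^ S.card := by
    calc A * ω ^ s * (‖L1‖ / 2) = A * ω⁻¹ ^ S.card * (‖L1‖ / 2) * (ω ^ s * ω ^ S.card) := by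
          linear_combination (-(A * ω ^ s * (‖L1‖ / 2))) * e1
      _ ≤ _ := i2
      _ = _ := by linear_combination ((L2 + 1) * B * ω ^ S.card) * e2
  rw [div_mul_eq_mul_div, div_mul_eq_mul_div, le_div_iff₀ (by positivity)]
  exact i3

lemma exp_le {l : Filter ℝ} [l.NeBot] (hl : l ≤ atTop) (K : ℝ) (p q : ℕ)
    (h : ∀ᶠ ω in l, ω ^ p ≤ K * ω ^ q) : p ≤ q := by
  by_contra! hpq
  obtain ⟨ω, h1, h2⟩ := (h.and (hl (eventually_gt_atTop (max 1 K)))).exists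
  have hω1 : 1 < ω := (le_max_left _ _).trans_lt h2
  have hωK : K < ω := (le_max_right _ _).trans_lt h2
  have : ω ^ (q+1) ≤ ω ^ p := pow_le_pow_right₀ hω1.le hpq
  have h3 : 0 < ω ^ q := by positivity
  rw [pow_succ] at this
  nlinarith

lemma tendsto_near {l : Filter ℝ} (hl : l ≤ atTop) {c ν : ℂ} {z : ℝ → ℂ}
    (h : Tendsto (fun ω : ℝ => (ω:ℂ) * (c - z ω)) l (𝓝 ν)) : Tendsto z l (𝓝 c) := by
  have hpos : ∀ᶠ ω in l, (0:ℝ) < ω := hl (eventually_gt_atTop 0)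
  have h1 := (h.mul (tendsto_theta hl)).mul_const (-Complex.I)
  have h2 : Tendsto (fun ω => c - z ω) l (𝓝 0) := by
    simp only [mul_zero, zero_mul] at h1
    refine h1.congr' ?_
    filter_upwards [hpos] with ω hω
    have : (ω:ℂ) ≠ 0 := by exact_mod_cast hω.ne'
    field_simp
    rw [Complex.I_sq]; ring
  simpa using h2.const_sub c

lemma card_le {N : ℕ} {l : Filter ℝ} [l.NeBot] (hl : l ≤ atTop) (y : ℝ → Fin N → ℂ) (c : ℂ)
    (hc : c = 1 ∨ c = -1) (Y : ℝ) (hY : ∀ᶠ ω in l, ∀ j, ‖y ω j‖ ≤ Y)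
    (S S' : Finset (Fin N)) (ν ν' : Fin N → ℂ)
    (hS : ∀ j ∈ S, Tendsto (fun ω : ℝ => (ω:ℂ) * (c - y ω j)) l (𝓝 (ν j)))
    (hS2 : ∀ j ∉ S, Tendsto (fun ω : ℝ => ‖(ω:ℂ) * (c - y ω j)‖) l atTop)
    (hS' : ∀ j ∈ S', Tendsto (fun ω : ℝ => (ω:ℂ) * (-c - y ω j)) l (𝓝 (ν' j)))
    (hdis : Disjoint S S')
    (s : ℕ) (hs : S.card + s + 1 = N)
    (K : ℝ) (hK : 0 < K) (h : ∀ᶠ ω in l, (∏ j, ‖sc y S c ω j‖) * ω ^ s ≤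
      K * (∏ j, ‖sc y S' (-c) ω j‖) * ω ^ S.card) : S'.card ≤ S.card := by
  have hcn : ‖c‖ = 1 := by rcases hc with rfl | rfl <;> simp
  have hpos : ∀ᶠ ω in l, (0:ℝ) < ω := hl (eventually_gt_atTop 0)
  have hge1 : ∀ᶠ ω in l, (1:ℝ) ≤ ω := hl (eventually_ge_atTop 1)
  have low : ∀ j, ∀ᶠ ω in l, (if j ∈ S' then 1 else ω⁻¹) ≤ ‖sc y S c ω j‖ := by
    intro j
    by_cases hj' : j ∈ S'
    · have hj : j ∉ S := fun h => Finset.disjoint_left.1 hdis h hj'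
      have t := ((tendsto_near hl (hS' j hj')).const_sub c).norm
      have t2 : ‖c - -c‖ = 2 := by
        rw [sub_neg_eq_add, ← two_mul, norm_mul, hcn]; simp
      rw [t2] at t
      filter_upwards [t.eventually_const_lt (by norm_num : (1:ℝ) < 2)] with ω h
      simp [sc, hj, hj', h.le]
    · by_cases hj : j ∈ S
      · filter_upwards [hpos] with ω hω
        simp [sc, hj, hj', abs_of_pos hω]
      · filter_upwards [hpos, (hS2 j hj).eventually_ge_atTop 1] with ω hω h
        simp only [sc, hj, hj', if_false]
        rw [norm_mul, Complex.norm_real, Real.norm_eq_abs, abs_of_pos hω] at h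
        rwa [inv_le_iff_one_le_mul₀' hω]
  have hup : ∀ᶠ ω in l, ∀ j, ‖sc y S' (-c) ω j‖ ≤ (if j ∈ S' then ω⁻¹ else 1) * (1 + |Y|) := by
    filter_upwards [hY, hpos] with ω h hω j
    have := abs_nonneg Y
    by_cases hj' : j ∈ S'
    · simp only [sc, hj', if_true, norm_inv, Complex.norm_real, Real.norm_eq_abs, abs_of_pos hω]
      have : 0 < ω⁻¹ := by positivity
      nlinarith
    · simp only [sc, hj', if_false]
      refine (norm_sub_le _ _).trans ?_
      rw [norm_neg, hcn]
      have := h j; have := le_abs_self Y; linarith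
  have cnt1 : ∀ ω : ℝ, ∏ j : Fin N, (if j ∈ S' then (1:ℝ) else ω⁻¹) = ω⁻¹ ^ (N - S'.card) := by
    intro ω
    rw [Finset.prod_ite]
    simp only [Finset.prod_const_one, one_mul, Finset.prod_const]
    congr 1
    rw [Finset.filter_not, Finset.card_sdiff]
    simp
  have cnt2 : ∀ ω : ℝ, ∏ j : Fin N, ((if j ∈ S' then ω⁻¹ else 1) * (1 + |Y|)) = ω⁻¹ ^ S'.card * (1+|Y|)^N := by
    intro ω
    rw [Finset.prod_mul_distrib, Finset.prod_ite]
    simp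
  have hb : S'.card ≤ N := by simpa using Finset.card_le_univ S'
  have fin : ∀ᶠ ω in l, ω ^ (s + 2 * S'.card) ≤ (K * (1 + |Y|)^N) * ω ^ (N + S.card) := by
    filter_upwards [eventually_all.2 low, hup, h, hpos] with ω low up h hω
    have l1 : ω⁻¹ ^ (N - S'.card) ≤ ∏ j, ‖sc y S c ω j‖ := by
      rw [← cnt1]
      refine Finset.prod_le_prod (fun j _ => ?_) (fun j _ => low j)
      split_ifs <;> positivity
    have u1 : ∏ j, ‖sc y S' (-c) ω j‖ ≤ ω⁻¹ ^ S'.card * (1+|Y|)^N := by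
      rw [← cnt2]
      exact Finset.prod_le_prod (fun j _ => norm_nonneg _) (fun j _ => up j)
    have m : ω⁻¹ ^ (N - S'.card) * ω ^ s ≤ K * (ω⁻¹ ^ S'.card * (1+|Y|)^N) * ω ^ S.card :=
      (mul_le_mul_of_nonneg_right l1 (by positivity)).trans (h.trans (by gcongr))
    have m2 := mul_le_mul_of_nonneg_right m (by positivity : 0 ≤ ω ^ N * ω ^ S'.card)
    have e1 : ω⁻¹ ^ (N - S'.card) * ω ^ N = ω ^ S'.card := by
      have : ω ^ N = ω ^ (N - S'.card) * ω ^ S'.card := by rw [← pow_add]; congr 1; omega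
      rw [this, ← mul_assoc, ← mul_pow, inv_mul_cancel₀ hω.ne']; simp
    have e2 : ω⁻¹ ^ S'.card * ω ^ S'.card = 1 := by rw [← mul_pow, inv_mul_cancel₀ hω.ne', one_pow]
    calc ω ^ (s + 2 * S'.card) = ω ^ s * ω ^ S'.card * ω ^ S'.card := by ring
      _ = ω⁻¹ ^ (N - S'.card) * ω ^ s * (ω ^ N * ω ^ S'.card) := by rw [← e1]; ring
      _ ≤ _ := m2
      _ = (K * (1 + |Y|)^N) * (ω ^ N * ω ^ S.card) * (ω⁻¹ ^ S'.card * ω ^ S'.card) := by ring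
      _ = _ := by rw [e2]; ring
  have := exp_le hl _ _ _ fin
  omega

lemma ultra_dich (l : Ultrafilter ℝ) (u : ℝ → ℂ) :
    (∃ ν, Tendsto u l (𝓝 ν)) ∨ Tendsto (fun ω => ‖u ω‖) l atTop := by
  by_cases h : ∃ R, ∀ᶠ ω in (l : Filter ℝ), ‖u ω‖ ≤ R
  · left
    obtain ⟨R, hR⟩ := h
    have := (isCompact_closedBall (0:ℂ) R).ultrafilter_le_nhds (l.map u) (by
      rw [le_principal_iff]
      change ∀ᶠ ω in (l : Filter ℝ), u ω ∈ Metric.closedBall 0 R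
      simpa using hR)
    obtain ⟨ν, _, h⟩ := this
    exact ⟨ν, h⟩
  · right
    push Not at h
    refine tendsto_atTop.2 fun R => ?_
    exact (h R).mono fun _ h => h.le

lemma structure_lem (n : ℕ) (hn : 1 ≤ n) (l : Ultrafilter ℝ) (hl : (l : Filter ℝ) ≤ atTop)
    (y : ℝ → Fin (2*n) → ℂ) (Y : ℝ) (hY : ∀ᶠ ω in (l : Filter ℝ), ∀ j, ‖y ω j‖ ≤ Y)
    (hEL : ∀ᶠ ω in (l : Filter ℝ), ∀ q : ℂ[X], q.natDegree < 2*n →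
      ‖EL ω 1 ((∏ j, (X - C (y ω j))) * q)‖ = ‖EL ω (-1) ((∏ j, (X - C (y ω j))) * q)‖) :
    ∃ S : Finset (Fin (2*n)), ∃ ν ν' : Fin (2*n) → ℂ, S.card = n ∧ Sᶜ.card = n ∧
      (∀ j ∈ S, Tendsto (fun ω : ℝ => (ω:ℂ) * (1 - y ω j)) l (𝓝 (ν j))) ∧
      (∀ j ∈ Sᶜ, Tendsto (fun ω : ℝ => (ω:ℂ) * (-1 - y ω j)) l (𝓝 (ν' j))) := by
  classical
  have ex : ∀ c : ℂ, ∃ S : Finset (Fin (2*n)), ∃ ν : Fin (2*n) → ℂ,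
      (∀ j ∈ S, Tendsto (fun ω : ℝ => (ω:ℂ) * (c - y ω j)) l (𝓝 (ν j))) ∧
      (∀ j ∉ S, Tendsto (fun ω : ℝ => ‖(ω:ℂ) * (c - y ω j)‖) l atTop) := by
    intro c
    have : ∀ j, ∃ ν, (Tendsto (fun ω : ℝ => (ω:ℂ) * (c - y ω j)) l (𝓝 ν)) ∨
        Tendsto (fun ω : ℝ => ‖(ω:ℂ) * (c - y ω j)‖) l atTop := by
      intro j
      rcases ultra_dich l (fun ω : ℝ => (ω:ℂ) * (c - y ω j)) with ⟨ν, h⟩ | h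
      · exact ⟨ν, Or.inl h⟩
      · exact ⟨0, Or.inr h⟩
    choose ν hν using this
    refine ⟨Finset.univ.filter fun j => Tendsto (fun ω : ℝ => (ω:ℂ) * (c - y ω j)) l (𝓝 (ν j)), ν, ?_, ?_⟩
    · intro j hj; simpa using hj
    · intro j hj
      exact (hν j).resolve_left (by simpa using hj)
  obtain ⟨S, ν, hS, hS2⟩ := ex 1
  obtain ⟨S', ν', hS', hS2'⟩ := ex (-1)
  have hdis : Disjoint S S' := by
    rw [Finset.disjoint_left]
    intro j h1 h2
    have := tendsto_nhds_unique (tendsto_near hl (hS j h1)) (tendsto_near hl (hS' j h2))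
    norm_num at this
  have hcard : S.card + S'.card ≤ 2 * n := by
    rw [← Finset.card_union_of_disjoint hdis]
    simpa using Finset.card_le_univ (S ∪ S')
  have hS_ : ∀ j ∈ S, Tendsto (fun ω : ℝ => (ω:ℂ) * (-(-1) - y ω j)) l (𝓝 (ν j)) := by simpa using hS
  have hS2_ : ∀ j ∉ S, Tendsto (fun ω : ℝ => ‖(ω:ℂ) * (-(-1) - y ω j)‖) l atTop := by
    simpa only [neg_neg] using hS2
  have A1 := fun s hs => one_sided hl y 1 (Or.inl rfl) S S' ν ν' hS hS2 hS' hS2' s hs hEL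
  have A2 := fun s hs => one_sided hl y (-1) (Or.inr rfl) S' S ν' ν hS' hS2' hS_ hS2_ s hs
    (by simpa only [neg_neg] using hEL.mono fun ω h q hq => (h q hq).symm)
  have c1 : S'.card ≤ S.card := by
    rcases lt_or_ge S.card (2*n) with h | h
    · obtain ⟨K, hK, hh⟩ := A1 (2*n - 1 - S.card) (by omega)
      exact card_le hl y 1 (Or.inl rfl) Y hY S S' ν ν' hS hS2 hS' hdis _ (by omega) K hK hh
    · omega
  have c2 : S.card ≤ S'.card := by
    rcases lt_or_ge S'.card (2*n) with h | h
    · obtain ⟨K, hK, hh⟩ := A2 (2*n - 1 - S'.card) (by omega)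
      exact card_le hl y (-1) (Or.inr rfl) Y hY S' S ν' ν hS' hS2' hS_ hdis.symm _ (by omega) K hK hh
    · omega
  have c3 : 2*n - 1 - S.card ≤ S.card := by
    obtain ⟨K, hK, h1⟩ := A1 (2*n - 1 - S.card) (by omega)
    obtain ⟨K', hK', h2⟩ := A2 (2*n - 1 - S.card) (by omega)
    have := exp_le hl (K * K') (2 * (2*n - 1 - S.card)) (2 * S.card) (by
      filter_upwards [h1, h2, (PT_main hl y 1 S ν hS hS2).1, (PT_main hl y (-1) S' ν' hS' hS2').1,
        hl (eventually_gt_atTop 0)] with ω h1 h2 p1 p2 hω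
      rw [neg_neg] at h2
      have P1 : 0 < ∏ j, ‖sc y S 1 ω j‖ := Finset.prod_pos fun j _ => norm_pos_iff.2 (p1 j)
      have P2 : 0 < ∏ j, ‖sc y S' (-1) ω j‖ := Finset.prod_pos fun j _ => norm_pos_iff.2 (p2 j)
      have hω' : 0 < ω := hω
      have m := mul_le_mul h1 h2 (by positivity) (by positivity)
      have ceq : S'.card = S.card := le_antisymm c1 c2
      rw [ceq] at m
      refine le_of_mul_le_mul_left (a := (∏ j, ‖sc y S 1 ω j‖) * ∏ j, ‖sc y S' (-1) ω j‖) ?_ (by positivity)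
      calc _ = _ := ?_
        _ ≤ _ := m
        _ = _ := ?_
      · ring
      · ring)
    omega
  have hSS : Sᶜ = S' := by
    have h1 : S' ⊆ Sᶜ := by
      intro j hj; rw [Finset.mem_compl]; exact fun h => Finset.disjoint_left.1 hdis h hj
    refine (Finset.eq_of_subset_of_card_le h1 ?_).symm
    rw [Finset.card_compl]; simp; omega
  refine ⟨S, ν, ν', by omega, by rw [hSS]; omega, hS, by rw [hSS]; exact hS'⟩

lemma EL_bound {N : ℕ} {l : Filter ℝ} (hl : l ≤ atTop) (y : ℝ → Fin N → ℂ) (c : ℂ)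
    (s T : Finset (Fin N)) (ν : Fin N → ℂ)
    (hT : ∀ j ∈ T, Tendsto (fun ω : ℝ => (ω:ℂ) * (c - y ω j)) l (𝓝 (ν j)))
    (hT2 : ∀ j ∉ T, Tendsto (fun ω : ℝ => y ω j) l (𝓝 (-c))) :
    ∃ K, 0 ≤ K ∧ ∀ᶠ ω in l, ‖EL ω c (∏ j ∈ s, (X - C (y ω j)))‖ ≤ K * ω⁻¹ ^ (s ∩ T).card := by
  have hpos : ∀ᶠ ω in l, (0:ℝ) < ω := hl (eventually_gt_atTop 0)
  let lam : ℝ → Fin N → ℂ := fun ω j => if j ∈ T then (ω:ℂ)⁻¹ else 1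
  have hP : PT l (fun ω => ∏ j ∈ s, (C ((c - y ω j) / lam ω j) + C ((Complex.I / ω) / lam ω j) * X))
      (∏ j ∈ s, (C (if j ∈ T then ν j else c - -c) + C (if j ∈ T then Complex.I else 0) * X)) := by
    refine PT.prod _ fun j _ => PT.linear ?_ ?_
    · by_cases hj : j ∈ T
      · simp only [hj, if_true, lam]
        refine (hT j hj).congr fun ω => ?_
        simp; ring
      · simp only [hj, if_false, lam, div_one]
        exact (hT2 j hj).const_sub c
    · by_cases hj : j ∈ T
      · simp only [hj, if_true, lam]
        refine tendsto_const_nhds.congr' ?_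
        filter_upwards [hpos] with ω hω
        have : (ω:ℂ) ≠ 0 := by exact_mod_cast hω.ne'
        field_simp
      · simp only [hj, if_false, lam, div_one]
        exact tendsto_theta hl
  have T1 := hP.lam.norm
  obtain ⟨K, hK, hup⟩ : ∃ K : ℝ, 0 ≤ K ∧ ∀ᶠ ω in l, ‖Lam (∏ j ∈ s, (C ((c - y ω j) / lam ω j) + C ((Complex.I / ω) / lam ω j) * X))‖ < K :=
    ⟨_, add_nonneg (norm_nonneg _) zero_le_one, T1.eventually_lt_const (lt_add_one _)⟩
  refine ⟨K, hK, ?_⟩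
  filter_upwards [hup, hpos] with ω hup hω
  unfold EL
  rw [comp_scale s (y ω) (lam ω) c (Complex.I / ω) (by
    intro j _
    have : (ω:ℂ) ≠ 0 := by exact_mod_cast hω.ne'
    simp only [lam]; split_ifs <;> simp [this]), Lam_C_mul, norm_mul]
  have e : ‖∏ j ∈ s, lam ω j‖ = ω⁻¹ ^ (s ∩ T).card := by
    simp only [lam]
    rw [Finset.prod_ite_mem, Finset.prod_const]
    simp [abs_of_pos hω]
  rw [e, mul_comm]
  exact mul_le_mul_of_nonneg_right hup.le (by positivity)

lemma weight_bound {n : ℕ} {l : Filter ℝ} [l.NeBot] (hl : l ≤ atTop) (y w : ℝ → Fin (2*n) → ℂ) (c : ℂ)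
    (hc : c = 1 ∨ c = -1) (S S' : Finset (Fin (2*n))) (hSS : S' = Sᶜ) (hc1 : S.card = n) (hc2 : S'.card = n)
    (ν ν' : Fin (2*n) → ℂ)
    (hS : ∀ j ∈ S, Tendsto (fun ω : ℝ => (ω:ℂ) * (c - y ω j)) l (𝓝 (ν j)))
    (hS' : ∀ j ∈ S', Tendsto (fun ω : ℝ => (ω:ℂ) * (-c - y ω j)) l (𝓝 (ν' j)))
    (κ : ℝ) (hκ : 0 < κ) (hsep : ∀ᶠ ω in l, ∀ i j : Fin (2*n), i ≠ j → κ / ω ≤ ‖y ω i - y ω j‖)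
    (j : Fin (2*n)) (hj : j ∈ S)
    (hw : ∀ᶠ ω in l, ω * ‖w ω j‖ * ∏ k ∈ Finset.univ.erase j, ‖y ω j - y ω k‖ ≤
      ‖EL ω c (∏ k ∈ Finset.univ.erase j, (X - C (y ω k)))‖ +
      ‖EL ω (-c) (∏ k ∈ Finset.univ.erase j, (X - C (y ω k)))‖) :
    ∃ K, ∀ᶠ ω in l, ω * ‖w ω j‖ ≤ K := by
  have hcn : ‖c‖ = 1 := by rcases hc with rfl | rfl <;> simp
  have hpos : ∀ᶠ ω in l, (0:ℝ) < ω := hl (eventually_gt_atTop 0)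
  have hone : ∀ᶠ ω in l, (1:ℝ) ≤ ω := hl (eventually_ge_atTop 1)
  obtain ⟨K1, hK1, h1⟩ := EL_bound hl y c (Finset.univ.erase j) S ν hS (by
    intro k hk
    exact tendsto_near hl (hS' k (by rw [hSS]; simpa using hk)))
  obtain ⟨K2, hK2, h2⟩ := EL_bound hl y (-c) (Finset.univ.erase j) S' ν' hS' (by
    intro k hk
    rw [neg_neg]
    exact tendsto_near hl (hS k (by rw [hSS] at hk; simpa using hk)))
  have n1 : (Finset.univ.erase j ∩ S).card = n - 1 := by
    rw [Finset.erase_inter, Finset.univ_inter, Finset.card_erase_of_mem hj, hc1]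
  have hjS' : j ∉ S' := by rw [hSS]; simpa using hj
  have n2 : (Finset.univ.erase j ∩ S').card = n := by
    rw [Finset.erase_inter, Finset.univ_inter, Finset.erase_eq_of_notMem hjS', hc2]
  rw [n1] at h1
  rw [n2] at h2
  have far : ∀ᶠ ω in l, ∀ k, k ∉ S → 1 ≤ ‖y ω j - y ω k‖ := by
    rw [eventually_all]
    intro k
    by_cases hk : k ∈ S
    · simp [hk]
    · have t := ((tendsto_near hl (hS j hj)).sub (tendsto_near hl (hS' k (by rw [hSS]; simpa using hk)))).norm
      have t2 : ‖c - -c‖ = 2 := by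
        rw [sub_neg_eq_add, ← two_mul, norm_mul, hcn]; simp
      rw [t2] at t
      filter_upwards [t.eventually_const_lt (by norm_num : (1:ℝ) < 2)] with ω h _
      exact h.le
  refine ⟨(K1 + K2) / κ ^ (n-1), ?_⟩
  filter_upwards [h1, h2, far, hw, hpos, hone, hsep] with ω h1 h2 far hw hω hone hsep
  have low : (κ / ω) ^ (n-1) ≤ ∏ k ∈ Finset.univ.erase j, ‖y ω j - y ω k‖ := by
    have e : ∏ k ∈ Finset.univ.erase j, (if k ∈ S then κ / ω else 1) = (κ / ω) ^ (n-1) := by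
      rw [Finset.prod_ite_mem, Finset.prod_const, n1]
    rw [← e]
    refine Finset.prod_le_prod (fun k _ => by split_ifs <;> positivity) fun k hk => ?_
    split_ifs with h
    · exact hsep j k (Finset.ne_of_mem_erase hk).symm
    · exact far k h
  have hn : n - 1 ≤ n := by omega
  have h2' : K2 * ω⁻¹ ^ n ≤ K2 * ω⁻¹ ^ (n-1) := by
    refine mul_le_mul_of_nonneg_left ?_ hK2
    exact pow_le_pow_of_le_one (by positivity) (inv_le_one_of_one_le₀ hone) hn
  have m : ω * ‖w ω j‖ * (κ / ω) ^ (n-1) ≤ (K1 + K2) * ω⁻¹ ^ (n-1) := by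
    refine (mul_le_mul_of_nonneg_left low (by positivity)).trans (hw.trans ?_)
    rw [add_mul]; linarith
  rw [div_eq_mul_inv, mul_pow, ← mul_assoc] at m
  have m2 := le_of_mul_le_mul_right m (by positivity)
  rwa [le_div_iff₀ (by positivity)]

/-- Hermite remainder -/
lemma hermite (L : List ℂ) : ∀ f : ℂ → ℂ, Differentiable ℂ f →
    ∃ (Q : ℂ[X]) (h : ℂ → ℂ), Q.degree < L.length ∧ Differentiable ℂ h ∧
      ∀ z, f z = Q.eval z + (L.map (fun a => z - a)).prod * h z := by
  induction L with
  | nil => intro f hf; exact ⟨0, f, by simp, hf, by simp⟩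
  | cons a L ih =>
    intro f hf
    have hd : Differentiable ℂ (dslope f a) := by
      rw [← differentiableOn_univ, Complex.differentiableOn_dslope (by simp)]
      exact hf.differentiableOn
    obtain ⟨Q, h, hQ, hh, e⟩ := ih _ hd
    refine ⟨C (f a) + (X - C a) * Q, h, ?_, hh, fun z => ?_⟩
    · refine (degree_add_le _ _).trans_lt (max_lt ?_ ?_)
      · refine degree_C_le.trans_lt ?_
        simp only [List.length_cons]
        exact_mod_cast Nat.succ_pos _
      · rw [degree_mul, degree_X_sub_C]
        by_cases hQ0 : Q = 0
        · simp [hQ0]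
        · rw [degree_eq_natDegree hQ0] at hQ ⊢
          have : Q.natDegree < L.length := by exact_mod_cast hQ
          simp only [List.length_cons]
          have h3 : 1 + Q.natDegree < L.length + 1 := by omega
          exact_mod_cast h3
    · have := sub_smul_dslope f a z
      rw [smul_eq_mul, e z] at this
      simp only [eval_add, eval_C, eval_mul, eval_sub, eval_X, List.map_cons, List.prod_cons]
      linear_combination -this

lemma decay (k : ℕ) : ∀ h : ℂ → ℂ, Differentiable ℂ h → ∃ C, 0 ≤ C ∧ ∀ ω : ℝ, 0 < ω →
    ‖∫ x in (-1:ℝ)..1, (((x:ℂ)^2 - 1)^k * h x) * Complex.exp (Complex.I * ω * x)‖ ≤ C / ω ^ (k+1) := by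
  have hexp : ∀ ω x : ℝ, ‖Complex.exp (Complex.I * ω * x)‖ = 1 := by
    intro ω x
    have : Complex.I * ω * x = ((ω * x : ℝ) : ℂ) * Complex.I := by push_cast; ring
    rw [this, Complex.norm_exp_ofReal_mul_I]
  have hnorm : ∀ ω : ℝ, 0 < ω → ‖(1 / (Complex.I * ω) : ℂ)‖ = 1 / ω := by
    intro ω hω; simp [abs_of_pos hω]
  induction k with
  | zero =>
    intro h hh
    have hd : Differentiable ℂ (deriv h) := by
      rw [← differentiableOn_univ]
      exact hh.differentiableOn.deriv isOpen_univ
    have hcont : Continuous fun x : ℝ => deriv h (x:ℂ) := hd.continuous.comp Complex.continuous_ofReal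
    obtain ⟨B, hB⟩ := (isCompact_Icc (a := (-1:ℝ)) (b := 1)).exists_bound_of_continuousOn hcont.continuousOn
    refine ⟨‖h 1‖ + ‖h (-1)‖ + |B| * 2, by positivity, fun ω hω => ?_⟩
    simp only [pow_zero, one_mul, zero_add, pow_one]
    rw [ibp ω hω (fun x : ℝ => h x) (fun x : ℝ => deriv h x) (fun x => (hh (x:ℂ)).hasDerivAt.comp_ofReal) hcont,
      norm_mul, hnorm ω hω, one_div, mul_comm, ← div_eq_mul_inv]
    refine div_le_div_of_nonneg_right ?_ hω.le
    have i : ‖∫ x in (-1:ℝ)..1, deriv h x * Complex.exp (Complex.I * ω * x)‖ ≤ |B| * |1 - (-1)| := by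
      refine intervalIntegral.norm_integral_le_of_norm_le_const fun x hx => ?_
      rw [Set.uIoc_of_le (by norm_num)] at hx
      rw [norm_mul, hexp, mul_one]
      exact (hB x ⟨hx.1.le, hx.2⟩).trans (le_abs_self B)
    have e1 := hexp ω 1
    have e2 := hexp ω (-1)
    push_cast at e1 e2
    rw [mul_one] at e1
    rw [mul_neg, mul_one] at e2
    refine (norm_sub_le _ _).trans (add_le_add ((norm_sub_le _ _).trans ?_) (i.trans ?_))
    · rw [norm_mul, norm_mul, e1, e2]; simp
    · norm_num
  | succ k ih =>
    intro h hh
    have hd : Differentiable ℂ (deriv h) := by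
      rw [← differentiableOn_univ]
      exact hh.differentiableOn.deriv isOpen_univ
    let h2 : ℂ → ℂ := fun z => 2 * (k+1) * z * h z + (z^2-1) * deriv h z
    have hh2 : Differentiable ℂ h2 := by fun_prop
    obtain ⟨C, hC, hb⟩ := ih h2 hh2
    refine ⟨C, hC, fun ω hω => ?_⟩
    have hder : ∀ x : ℝ, HasDerivAt (fun x : ℝ => ((x:ℂ)^2 - 1)^(k+1) * h x) (((x:ℂ)^2 - 1)^k * h2 x) x := by
      intro x
      have d1 : HasDerivAt (fun z : ℂ => (z^2 - 1)^(k+1) * h z) ((((x:ℂ))^2 - 1)^k * h2 x) (x:ℂ) := by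
        have a1 := (((hasDerivAt_id (x:ℂ)).pow 2).sub_const 1).pow (k+1)
        have a2 := a1.mul (hh (x:ℂ)).hasDerivAt
        refine a2.congr_deriv ?_
        simp [h2]; ring
      exact d1.comp_ofReal
    have hc2 : Continuous fun x : ℝ => ((x:ℂ)^2 - 1)^k * h2 x := by
      have := hh2.continuous.comp Complex.continuous_ofReal
      exact (by fun_prop : Continuous fun x : ℝ => ((x:ℂ)^2 - 1)^k).mul this
    rw [ibp ω hω (fun x : ℝ => ((x:ℂ)^2 - 1)^(k+1) * h x) _ hder hc2, norm_mul, hnorm ω hω]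
    have z : ((((1:ℝ):ℂ)^2 - 1)^(k+1) * h ((1:ℝ):ℂ)) * Complex.exp (Complex.I * ω) - ((((-1:ℝ):ℂ))^2 - 1)^(k+1) * h ((-1:ℝ):ℂ) * Complex.exp (-(Complex.I * ω)) = 0 := by simp
    rw [z, zero_sub, norm_neg]
    refine (mul_le_mul_of_nonneg_left (hb ω hω) (by positivity)).trans (le_of_eq ?_)
    rw [div_mul_div_comm, one_mul, ← pow_succ']

lemma norm_e (ω : ℝ) : ‖Complex.exp (Complex.I * ω)‖ = 1 ∧ ‖Complex.exp (-(Complex.I * ω))‖ = 1 := by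
  constructor
  · rw [mul_comm, Complex.norm_exp_ofReal_mul_I]
  · have : -(Complex.I * ω) = ((-ω : ℝ) : ℂ) * Complex.I := by push_cast; ring
    rw [this, Complex.norm_exp_ofReal_mul_I]

lemma int_sum (ω : ℝ) (P q : ℂ[X]) (m : ℕ) (hq : q.natDegree < m) :
    ∫ x in (-1:ℝ)..1, (P * q).eval (x:ℂ) * Complex.exp (Complex.I * ω * x) =
      ∑ k ∈ Finset.range m, q.coeff k *
        ∫ x in (-1:ℝ)..1, P.eval (x:ℂ) * (x:ℂ)^k * Complex.exp (Complex.I * ω * x) := by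
  simp_rw [← intervalIntegral.integral_const_mul]
  rw [← intervalIntegral.integral_finsetSum]
  · congr 1
    ext x
    rw [eval_mul, eval_eq_sum_range' hq, Finset.mul_sum, Finset.sum_mul]
    refine Finset.sum_congr rfl fun k _ => ?_
    ring
  · intro k _
    exact (by fun_prop : Continuous _).intervalIntegrable _ _

lemma root_bound (N : ℕ) (p : ℂ[X]) (B : ℝ) (hm : p.Monic) (hB : ∀ k, ‖p.coeff k‖ ≤ B) (z : ℂ)
    (hz : p.IsRoot z) : ‖z‖ ≤ B + 1 := by
  have h1 := hz.norm_lt_cauchyBound hm.ne_zero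
  have hB0 : 0 ≤ B := (norm_nonneg _).trans (hB 0)
  have h2 : (cauchyBound p : ℝ) ≤ B + 1 := by
    lift B to NNReal using hB0
    have : cauchyBound p ≤ B + 1 := by
      unfold cauchyBound
      gcongr
      rw [hm.leadingCoeff]
      simp only [nnnorm_one, div_one]
      exact Finset.sup_le fun k _ => hB k
    exact_mod_cast this
  have h3 : ‖z‖ < (cauchyBound p : ℝ) := by exact_mod_cast h1
  linarith

lemma uniform_bound
    (n : ℕ) (hn : 1 ≤ n) (Ω : ℝ) (hΩ : 0 < Ω) (y w : ℝ → Fin (2 * n) → ℂ)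
    (Y : ℝ) (hY : ∀ ω ≥ Ω, ∀ j, ‖y ω j‖ ≤ Y)
    (hEL : ∀ ω ≥ Ω, ∀ q : ℂ[X], q.natDegree < 2*n →
      ‖EL ω 1 ((∏ j, (X - C (y ω j))) * q)‖ = ‖EL ω (-1) ((∏ j, (X - C (y ω j))) * q)‖)
    (κ : ℝ) (hκ : 0 < κ) (hsep : ∀ ω ≥ Ω, ∀ i j : Fin (2*n), i ≠ j → κ / ω ≤ ‖y ω i - y ω j‖)
    (j : Fin (2*n))
    (hw : ∀ ω ≥ Ω, w ω j * ∏ k ∈ Finset.univ.erase j, (y ω j - y ω k) =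
      ∫ x in (-1:ℝ)..1, (∏ k ∈ Finset.univ.erase j, (X - C (y ω k))).eval (x:ℂ) * Complex.exp (Complex.I * ω * x)) :
    ∃ K, ∀ ω ≥ Ω, ω^(2*n+1) * (‖w ω j‖ * ‖(y ω j)^2 - 1‖^(2*n)) ≤ K := by
  have hY0 : 0 ≤ Y := (norm_nonneg _).trans (hY Ω le_rfl j)
  by_contra! hcon
  set u : ℝ → ℝ := fun ω => ω^(2*n+1) * (‖w ω j‖ * ‖(y ω j)^2 - 1‖^(2*n)) with hu
  have hne : (𝓟 (Set.Ici Ω) ⊓ comap u atTop).NeBot := by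
    rw [inf_comm, inf_principal_neBot_iff]
    intro U hU
    obtain ⟨V, hV, hVU⟩ := hU
    obtain ⟨a, ha⟩ := mem_atTop_sets.1 hV
    obtain ⟨ω, hω, h⟩ := hcon a
    exact ⟨ω, hVU (ha _ h.le), hω⟩
  let l := Ultrafilter.of (𝓟 (Set.Ici Ω) ⊓ comap u atTop)
  have hl0 : (l : Filter ℝ) ≤ 𝓟 (Set.Ici Ω) ⊓ comap u atTop := Ultrafilter.of_le _
  have hlΩ : ∀ᶠ ω in (l : Filter ℝ), ω ≥ Ω := le_principal_iff.1 (hl0.trans inf_le_left)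
  have hlu : Tendsto u l atTop := tendsto_iff_comap.2 (hl0.trans inf_le_right)
  suffices hs : ∃ K, ∀ᶠ ω in (l : Filter ℝ), u ω ≤ K by
    obtain ⟨K, hK⟩ := hs
    obtain ⟨ω, h1, h2⟩ := (hK.and (hlu.eventually_gt_atTop K)).exists
    linarith
  by_cases hb : ∃ M, ∀ᶠ ω in (l : Filter ℝ), ω ≤ M
  · obtain ⟨M, hM⟩ := hb
    refine ⟨M^(2*n+1) * (((1+Y)^(2*n-1) * 2 / (κ/M)^(2*n-1)) * (Y^2+1)^(2*n)), ?_⟩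
    filter_upwards [hM, hlΩ] with ω hM hω
    have hω0 : 0 < ω := hΩ.trans_le hω
    have hM0 : 0 < M := hω0.trans_le hM
    have b1 : ‖(y ω j)^2 - 1‖ ≤ Y^2 + 1 := by
      refine (norm_sub_le _ _).trans ?_
      rw [norm_pow, norm_one]
      have := hY ω hω j
      gcongr
    have b2 : ‖w ω j‖ * (κ/M)^(2*n-1) ≤ (1+Y)^(2*n-1) * 2 := by
      have i := intervalIntegral.norm_integral_le_of_norm_le_const (a := (-1:ℝ)) (b := 1) (C := (1+Y)^(2*n-1))
        (f := fun x : ℝ => (∏ k ∈ Finset.univ.erase j, (X - C (y ω k))).eval (x:ℂ) * Complex.exp (Complex.I * ω * x)) (by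
          intro x hx
          rw [Set.uIoc_of_le (by norm_num)] at hx
          have e : Complex.I * ω * x = Complex.I * ((ω * x : ℝ) : ℂ) := by push_cast; ring
          rw [norm_mul, e, (norm_e _).1, mul_one, eval_prod, norm_prod]
          calc _ ≤ ∏ k ∈ Finset.univ.erase j, (1+Y) := by
                refine Finset.prod_le_prod (fun _ _ => norm_nonneg _) fun k _ => ?_
                simp only [eval_sub, eval_X, eval_C]
                refine (norm_sub_le _ _).trans (add_le_add ?_ (hY ω hω k))
                rw [Complex.norm_real, Real.norm_eq_abs, abs_le]
                exact ⟨hx.1.le, hx.2⟩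
            _ = _ := by rw [Finset.prod_const, Finset.card_erase_of_mem (Finset.mem_univ _)]; simp)
      rw [← hw ω hω, norm_mul, norm_prod] at i
      have e2 : |(1:ℝ) - (-1)| = 2 := by norm_num
      rw [e2] at i
      refine le_trans (mul_le_mul_of_nonneg_left ?_ (norm_nonneg _)) i
      calc (κ/M)^(2*n-1) = ∏ k ∈ Finset.univ.erase j, (κ/M) := by
            rw [Finset.prod_const, Finset.card_erase_of_mem (Finset.mem_univ _)]; simp
        _ ≤ _ := by
            refine Finset.prod_le_prod (fun _ _ => by positivity) fun k hk => ?_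
            refine le_trans ?_ (hsep ω hω j k (Finset.ne_of_mem_erase hk).symm)
            gcongr
    have b3 : ‖w ω j‖ ≤ (1+Y)^(2*n-1) * 2 / (κ/M)^(2*n-1) := by
      rwa [le_div_iff₀ (by positivity)]
    simp only [hu]
    gcongr
  · have hl : (l : Filter ℝ) ≤ atTop := by
      push Not at hb
      have : Tendsto id (l : Filter ℝ) atTop := tendsto_atTop.2 fun M => by
        have := hb M
        filter_upwards [this] with ω h
        exact h.le
      exact this
    have hpos : ∀ᶠ ω in (l : Filter ℝ), (0:ℝ) < ω := hl (eventually_gt_atTop 0)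
    obtain ⟨S, ν, ν', hc1, hc2, hS, hS'⟩ := structure_lem n hn l hl y Y
      (hlΩ.mono fun ω h => hY ω h) (hlΩ.mono fun ω h => hEL ω h)
    have hwb : ∀ᶠ ω in (l : Filter ℝ), ω * ‖w ω j‖ * ∏ k ∈ Finset.univ.erase j, ‖y ω j - y ω k‖ ≤
      ‖EL ω 1 (∏ k ∈ Finset.univ.erase j, (X - C (y ω k)))‖ +
      ‖EL ω (-1) (∏ k ∈ Finset.univ.erase j, (X - C (y ω k)))‖ := by
      filter_upwards [hlΩ, hpos] with ω hω hω0
      have := hw ω hω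
      rw [I_eq ω hω0 _ _ le_rfl] at this
      have h2 := congrArg norm this
      rw [norm_mul, norm_prod, norm_mul] at h2
      have h3 : ‖(1 / (Complex.I * ω) : ℂ)‖ = 1 / ω := by simp [abs_of_pos hω0]
      rw [mul_assoc, h2, h3, ← mul_assoc, mul_one_div_cancel hω0.ne', one_mul]
      refine (norm_sub_le _ _).trans (le_of_eq ?_)
      rw [norm_mul, norm_mul, (norm_e ω).1, (norm_e ω).2, one_mul, one_mul]
    have fin : ∀ c ν0 : ℂ, (c = 1 ∨ c = -1) → Tendsto (fun ω : ℝ => (ω:ℂ) * (c - y ω j)) l (𝓝 ν0) →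
        (∃ K, ∀ᶠ ω in (l : Filter ℝ), ω * ‖w ω j‖ ≤ K) → ∃ K, ∀ᶠ ω in (l : Filter ℝ), u ω ≤ K := by
      rintro c ν0 hc ht ⟨K, hK⟩
      have hc1 : c^2 = 1 := by rcases hc with rfl | rfl <;> simp
      have hcn : ‖c‖ = 1 := by rcases hc with rfl | rfl <;> simp
      refine ⟨K * ((‖ν0‖ + 1) * (1 + Y))^(2*n), ?_⟩
      filter_upwards [hK, hlΩ, hpos, ht.norm.eventually_lt_const (lt_add_one _)] with ω hK hω hω0 ht
      have e : ω * ‖(y ω j)^2 - 1‖ = ‖(ω:ℂ) * (c - y ω j)‖ * ‖c + y ω j‖ := by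
        have : (y ω j)^2 - 1 = -((c - y ω j) * (c + y ω j)) := by rw [← hc1]; ring
        rw [this, norm_neg, norm_mul, norm_mul, Complex.norm_real, Real.norm_eq_abs, abs_of_pos hω0]; ring
      have b : ω * ‖(y ω j)^2 - 1‖ ≤ (‖ν0‖ + 1) * (1 + Y) := by
        rw [e]
        have : ‖c + y ω j‖ ≤ 1 + Y := (norm_add_le _ _).trans (by rw [hcn]; linarith [hY ω hω j])
        exact mul_le_mul ht.le this (norm_nonneg _) (by positivity)
      calc u ω = (ω * ‖w ω j‖) * (ω * ‖(y ω j)^2 - 1‖)^(2*n) := by simp only [hu]; ring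
        _ ≤ _ := by
          have : 0 ≤ ω * ‖w ω j‖ := by positivity
          exact mul_le_mul hK (pow_le_pow_left₀ (by positivity) b _) (by positivity) (this.trans hK)
    by_cases hj : j ∈ S
    · exact fin 1 _ (Or.inl rfl) (hS j hj) (weight_bound hl y w 1 (Or.inl rfl) S Sᶜ rfl hc1 hc2 ν ν' hS hS' κ hκ
        (hlΩ.mono fun ω h => hsep ω h) j hj hwb)
    · have hj' : j ∈ Sᶜ := by simpa using hj
      exact fin (-1) _ (Or.inr rfl) (hS' j hj') (weight_bound hl y w (-1) (Or.inr rfl) Sᶜ S (by simp) hc2 hc1 ν' ν hS'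
        (by simpa only [neg_neg] using hS) κ hκ
        (hlΩ.mono fun ω h => hsep ω h) j hj' (by simpa only [neg_neg, add_comm] using hwb))

theorem gaussian_rule_asymptotic_order
    (n : ℕ) (hn : 1 ≤ n) (Ω : ℝ) (hΩ : 0 < Ω)
    (p : ℝ → Polynomial ℂ) (y w : ℝ → Fin (2 * n) → ℂ)
    (hmonic : ∀ ω ≥ Ω, (p ω).Monic ∧ (p ω).natDegree = 2 * n)
    (horth : ∀ ω ≥ Ω, ∀ k < 2 * n, ∫ x in (-1 : ℝ)..1,
      (p ω).eval (x : ℂ) * (x : ℂ) ^ k * Complex.exp (Complex.I * ω * x) = 0)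
    (hbound : ∃ B : ℝ, ∀ ω ≥ Ω, ∀ k : ℕ, ‖(p ω).coeff k‖ ≤ B)
    (hroots : ∀ ω ≥ Ω, p ω = ∏ j, (X - Polynomial.C (y ω j)))
    (hdistinct : ∀ ω ≥ Ω, Function.Injective (y ω))
    (hsep : ∃ c : ℝ, 0 < c ∧ ∀ ω ≥ Ω, ∀ i j : Fin (2 * n), i ≠ j →
      c / ω ≤ ‖y ω i - y ω j‖)
    (hGLexists : ∃ ξ η : Fin n → ℝ, (∀ j, 0 < ξ j) ∧ Function.Injective ξ ∧
      ∀ q : Polynomial ℝ, q.natDegree ≤ 2 * n - 1 →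
        ∑ j, η j * q.eval (ξ j) = ∫ t in Set.Ioi (0 : ℝ), q.eval t * Real.exp (-t))
    (hweights : ∀ ω ≥ Ω, ∀ k < 4 * n,
      ∑ j, w ω j * (y ω j) ^ k =
        ∫ t in (-1 : ℝ)..1, (t : ℂ) ^ k * Complex.exp (Complex.I * ω * t)) :
    ∀ f : ℂ → ℂ, Differentiable ℂ f → ∃ C : ℝ, ∀ ω ≥ Ω,
      ‖(∑ j, w ω j * f (y ω j)) -
          ∫ t in (-1 : ℝ)..1, f (t : ℂ) * Complex.exp (Complex.I * ω * t)‖ ≤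
        C / ω ^ (2 * n + 1) := by
  intro f hf
  obtain ⟨κ, hκ, hsep⟩ := hsep
  obtain ⟨B, hB⟩ := hbound
  have hY : ∀ ω ≥ Ω, ∀ j, ‖y ω j‖ ≤ B + 1 := by
    intro ω hω j
    refine root_bound (2*n) (p ω) B (hmonic ω hω).1 (hB ω hω) _ ?_
    rw [hroots ω hω, IsRoot, eval_prod]
    exact Finset.prod_eq_zero (Finset.mem_univ j) (by simp)
  have hex : ∀ ω ≥ Ω, ∀ Q : ℂ[X], Q.natDegree < 4*n → ∑ j, w ω j * Q.eval (y ω j) =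
      ∫ t in (-1 : ℝ)..1, Q.eval (t : ℂ) * Complex.exp (Complex.I * ω * t) := by
    intro ω hω Q hQ
    have := int_sum ω 1 Q (4*n) hQ
    rw [one_mul] at this
    rw [this]
    simp_rw [eval_one, one_mul, eval_eq_sum_range' hQ, Finset.mul_sum]
    rw [Finset.sum_comm]
    refine Finset.sum_congr rfl fun k hk => ?_
    rw [← hweights ω hω k (Finset.mem_range.1 hk), Finset.mul_sum]
    refine Finset.sum_congr rfl fun j _ => ?_
    ring
  have hEL : ∀ ω ≥ Ω, ∀ q : ℂ[X], q.natDegree < 2*n →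
      ‖EL ω 1 ((∏ j, (X - C (y ω j))) * q)‖ = ‖EL ω (-1) ((∏ j, (X - C (y ω j))) * q)‖ := by
    intro ω hω q hq
    have hω0 : 0 < ω := hΩ.trans_le hω
    have h0 := int_sum ω (p ω) q (2*n) hq
    rw [Finset.sum_eq_zero (fun k hk => by rw [horth ω hω k (Finset.mem_range.1 hk), mul_zero]),
      I_eq ω hω0 _ _ le_rfl, hroots ω hω] at h0
    have hne : (1 / (Complex.I * ω) : ℂ) ≠ 0 := by simp [hω0.ne']
    have h1 := sub_eq_zero.1 ((mul_eq_zero.1 h0).resolve_left hne)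
    have h2 := congrArg norm h1
    rwa [norm_mul, norm_mul, (norm_e ω).1, (norm_e ω).2, one_mul, one_mul] at h2
  have hw : ∀ j, ∀ ω ≥ Ω, w ω j * ∏ k ∈ Finset.univ.erase j, (y ω j - y ω k) =
      ∫ x in (-1:ℝ)..1, (∏ k ∈ Finset.univ.erase j, (X - C (y ω k))).eval (x:ℂ) * Complex.exp (Complex.I * ω * x) := by
    intro j ω hω
    rw [← hex ω hω _ (by
      rw [natDegree_prod_of_monic _ _ (fun k _ => monic_X_sub_C _)]
      simp; omega)]
    rw [Finset.sum_eq_single j]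
    · simp [eval_prod]
    · intro i _ hij
      rw [eval_prod, Finset.prod_eq_zero (i := i) (by simp [hij]) (by simp), mul_zero]
    · simp
  have hub := fun j => uniform_bound n hn Ω hΩ y w (B+1) hY hEL κ hκ hsep j (hw j)
  choose K hK using hub
  obtain ⟨Q, h, hQ, hh, e⟩ := hermite (List.replicate (2*n) 1 ++ List.replicate (2*n) (-1)) f hf
  have hQ' : Q.natDegree < 4*n := by
    rcases eq_or_ne Q 0 with rfl | hQ0
    · simp; omega
    · rw [degree_eq_natDegree hQ0] at hQ
      have : Q.natDegree < (List.replicate (2*n) (1:ℂ) ++ List.replicate (2*n) (-1)).length := by exact_mod_cast hQ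
      simp at this; omega
  have e' : ∀ z, f z = Q.eval z + ((z^2 - 1)^(2*n) * h z) := by
    intro z
    rw [e z]
    simp only [List.map_append, List.map_replicate, List.prod_append, List.prod_replicate]
    rw [← mul_pow]
    ring
  obtain ⟨Cd, hCd, hdec⟩ := decay (2*n) h hh
  obtain ⟨H, hH⟩ := (isCompact_closedBall (0:ℂ) (B+1)).exists_bound_of_continuousOn hh.continuous.continuousOn
  refine ⟨(∑ j, K j * |H|) + Cd, fun ω hω => ?_⟩
  have hω0 : 0 < ω := hΩ.trans_le hω
  have hhc : Continuous fun x : ℝ => h (x:ℂ) := hh.continuous.comp Complex.continuous_ofReal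
  have eq : (∑ j, w ω j * f (y ω j)) - ∫ t in (-1 : ℝ)..1, f (t : ℂ) * Complex.exp (Complex.I * ω * t) =
      (∑ j, w ω j * (((y ω j)^2 - 1)^(2*n) * h (y ω j))) -
       ∫ t in (-1 : ℝ)..1, (((t:ℂ)^2 - 1)^(2*n) * h t) * Complex.exp (Complex.I * ω * t) := by
    simp_rw [e', mul_add, add_mul]
    rw [Finset.sum_add_distrib, intervalIntegral.integral_add, hex ω hω Q hQ']
    · ring
    · exact (by fun_prop : Continuous _).intervalIntegrable _ _
    · exact (((by fun_prop : Continuous fun t : ℝ => ((t:ℂ)^2 - 1)^(2*n)).mul hhc).mul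
        (by fun_prop : Continuous fun t : ℝ => Complex.exp (Complex.I * ω * t))).intervalIntegrable _ _
  rw [eq, add_div]
  refine (norm_sub_le _ _).trans (add_le_add ?_ (hdec ω hω0))
  rw [Finset.sum_div]
  refine (norm_sum_le _ _).trans (Finset.sum_le_sum fun j _ => ?_)
  rw [le_div_iff₀ (by positivity), norm_mul, norm_mul, norm_pow]
  have a1 := hK j ω hω
  have a2 : ‖h (y ω j)‖ ≤ |H| := (hH _ (by simpa using hY ω hω j)).trans (le_abs_self H)
  calc _ = (ω^(2*n+1) * (‖w ω j‖ * ‖(y ω j)^2 - 1‖^(2*n))) * ‖h (y ω j)‖ := by ring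
    _ ≤ _ := by
      have : 0 ≤ ω^(2*n+1) * (‖w ω j‖ * ‖(y ω j)^2 - 1‖^(2*n)) := by positivity
      exact mul_le_mul a1 a2 (norm_nonneg _) (this.trans a1)
end

section
/- Let ω > 0. If sin(ω) ≠ 0, then the monic polynomial p_1(x) = x + a_0 with a_0 = i·cos(ω)/sin(ω) − i/ω satisfies ∫_{−1}^{1} p_1(x)·e^{iωx} dx = 0, and it is the unique monic polynomial of degree 1 with this property. If instead ω = kπ for a positive integer k (so sin(ω) = 0), then no monic polynomial of degree 1 satisfies ∫_{−1}^{1} (x + a)·e^{iωx} dx = 0 for any a ∈ ℂ. -/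
open MeasureTheory

theorem key_integral (ω : ℝ) (hω : 0 < ω) (a : ℂ) :
    (∫ x in (-1 : ℝ)..1, ((x : ℂ) + a) * Complex.exp (Complex.I * ω * x)) =
      (2 * a * ω * (Real.sin ω : ℂ) + 2 * Complex.I * (Real.sin ω : ℂ)
        - 2 * Complex.I * ω * (Real.cos ω : ℂ)) / (ω : ℂ) ^ 2 := by
  have hw : (ω : ℂ) ≠ 0 := by exact_mod_cast hω.ne'
  have hd : ∀ x ∈ Set.uIcc (-1 : ℝ) 1, HasDerivAt
      (fun x : ℝ => (-Complex.I * ((x : ℂ) + a) / ω + 1 / (ω : ℂ) ^ 2) *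
        Complex.exp (Complex.I * ω * x))
      (((x : ℂ) + a) * Complex.exp (Complex.I * ω * x)) x := by
    intro x _
    have h0 : HasDerivAt (fun x : ℝ => (x : ℂ)) 1 x := Complex.ofRealCLM.hasDerivAt
    have h1 := (((h0.add_const a).const_mul (-Complex.I)).div_const (ω : ℂ)).add_const
      (1 / (ω : ℂ) ^ 2)
    have h2 := (h0.const_mul (Complex.I * ω)).cexp
    refine (h1.mul h2).congr_deriv ?_
    field_simp
    ring_nf
    simp only [Complex.I_sq]
    ring
  rw [intervalIntegral.integral_eq_sub_of_hasDerivAt hd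
    (Continuous.intervalIntegrable (by fun_prop) _ _)]
  have e1 : Complex.exp (Complex.I * ω * ((1 : ℝ) : ℂ)) =
      (Real.cos ω : ℂ) + (Real.sin ω : ℂ) * Complex.I := by
    rw [Complex.ofReal_cos, Complex.ofReal_sin, ← Complex.exp_mul_I]
    congr 1
    push_cast
    ring
  have e2 : Complex.exp (Complex.I * ω * ((-1 : ℝ) : ℂ)) =
      (Real.cos ω : ℂ) - (Real.sin ω : ℂ) * Complex.I := by
    have : Complex.I * ω * ((-1 : ℝ) : ℂ) = (-(ω : ℂ)) * Complex.I := by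
      push_cast
      ring
    rw [this, Complex.exp_mul_I, Complex.cos_neg, Complex.sin_neg, Complex.ofReal_cos,
      Complex.ofReal_sin]
    ring
  simp only [e1, e2]
  generalize (Real.cos ω : ℂ) = c
  generalize (Real.sin ω : ℂ) = s
  push_cast
  field_simp
  ring_nf
  simp only [Complex.I_sq]
  ring

theorem degree_one_orthogonal_polynomial (ω : ℝ) (hω : 0 < ω) :
    (Real.sin ω ≠ 0 →
      ((∫ x in (-1 : ℝ)..1,
          ((x : ℂ) + (Complex.I * (Real.cos ω : ℂ) / (Real.sin ω : ℂ) - Complex.I / (ω : ℂ))) *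
            Complex.exp (Complex.I * ω * x)) = 0 ∧
        ∀ a : ℂ, (∫ x in (-1 : ℝ)..1,
            ((x : ℂ) + a) * Complex.exp (Complex.I * ω * x)) = 0 →
          a = Complex.I * (Real.cos ω : ℂ) / (Real.sin ω : ℂ) - Complex.I / (ω : ℂ))) ∧
    (∀ k : ℕ, 0 < k → ω = k * Real.pi →
      ∀ a : ℂ, (∫ x in (-1 : ℝ)..1,
          ((x : ℂ) + a) * Complex.exp (Complex.I * ω * x)) ≠ 0) := by
  have hw : (ω : ℂ) ≠ 0 := by exact_mod_cast hω.ne'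
  refine ⟨fun hs => ?_, ?_⟩
  · have hs' : (Real.sin ω : ℂ) ≠ 0 := by exact_mod_cast hs
    refine ⟨?_, fun a ha => ?_⟩
    · rw [key_integral ω hω]
      generalize (Real.cos ω : ℂ) = c at *
      generalize (Real.sin ω : ℂ) = s at *
      field_simp
      ring
    · rw [key_integral ω hω, div_eq_zero_iff] at ha
      have ha := ha.resolve_right (pow_ne_zero 2 hw)
      generalize (Real.cos ω : ℂ) = c at *
      generalize (Real.sin ω : ℂ) = s at *
      field_simp
      linear_combination ha / 2
  · intro k _ hk a ha
    have hs : Real.sin ω = 0 := by rw [hk]; exact Real.sin_nat_mul_pi k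
    have hc : Real.cos ω ≠ 0 := by
      intro h
      have := Real.sin_sq_add_cos_sq ω
      rw [hs, h] at this
      norm_num at this
    have hc' : (Real.cos ω : ℂ) ≠ 0 := by exact_mod_cast hc
    rw [key_integral ω hω, hs, div_eq_zero_iff] at ha
    have ha := ha.resolve_right (pow_ne_zero 2 hw)
    have h3 : 2 * Complex.I * ω * (Real.cos ω : ℂ) ≠ 0 :=
      mul_ne_zero (mul_ne_zero (mul_ne_zero two_ne_zero Complex.I_ne_zero) hw) hc'
    apply h3
    rw [Complex.ofReal_zero] at ha
    linear_combination -ha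
end

section
/- Define N : ℝ → ℝ by N(ω) = 2ω³·cos(ω) + ω²·(ω² − 3)·sin(ω) + (sin(ω))³. Then there exist a constant C > 0 and an integer K such that for every integer k ≥ K there exists ω_k ∈ ℝ with N(ω_k) = 0 and |ω_k − kπ + 2/(kπ)| ≤ C·k^{−3}; that is, the zeros ω_k satisfy ω_k = kπ − 2/(kπ) + O(k^{−3}) as k → ∞. -/
theorem aux_upper (v : ℝ) (h0 : 0 < v) (h1 : v ≤ 1 / 900) :
    2 * (1 - 2*v - 20*v^2) ≤ ((1 - 2*v - 20*v^2)^2 - 3*v) * ((2 + 20*v) * (1 - v*(1+10*v)^2)) := by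
  have hv2 : v^2 ≤ v / 900 := by nlinarith
  have e1 : 1 - 8*v ≤ (1 - 2*v - 20*v^2)^2 - 3*v := by nlinarith [sq_nonneg (2*v+20*v^2)]
  have e2 : 1 - 1.5*v ≤ 1 - v*(1+10*v)^2 := by
    have : (1+10*v)^2 ≤ 1.5 := by nlinarith
    nlinarith
  have e3 : (2+20*v) * (1 - 1.5*v) ≤ (2 + 20*v) * (1 - v*(1+10*v)^2) :=
    mul_le_mul_of_nonneg_left e2 (by linarith)
  have e4 : (1-8*v) * ((2+20*v) * (1 - 1.5*v)) ≤ _ :=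
    mul_le_mul e1 e3 (mul_nonneg (by linarith) (by linarith)) (by linarith)
  refine le_trans ?_ e4
  have : 0 ≤ v^3 := by positivity
  nlinarith

theorem asymptotics_of_critical_frequencies :
    ∃ C : ℝ, 0 < C ∧ ∃ K : ℕ, ∀ k : ℕ, K ≤ k → ∃ ωk : ℝ,
      (2 * ωk ^ 3 * Real.cos ωk + ωk ^ 2 * (ωk ^ 2 - 3) * Real.sin ωk +
          (Real.sin ωk) ^ 3 = 0) ∧
        |ωk - k * Real.pi + 2 / (k * Real.pi)| ≤ C / (k : ℝ) ^ 3 := by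
  refine ⟨20, by norm_num, 10, fun k hk => ?_⟩
  have hk' : (10:ℝ) ≤ k := by exact_mod_cast hk
  have hpi := Real.pi_gt_three
  obtain ⟨a, ha⟩ : ∃ a : ℝ, a = k * Real.pi := ⟨_, rfl⟩
  have ha30 : 30 ≤ a := by rw [ha]; nlinarith
  have hak : (k:ℝ) ≤ a := by rw [ha]; nlinarith
  have hapos : 0 < a := by linarith
  obtain ⟨u, hu⟩ : ∃ u : ℝ, u = 1 / a := ⟨_, rfl⟩
  have hua : u * a = 1 := by rw [hu]; field_simp
  have hu0 : 0 < u := by rw [hu]; positivity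
  have hu1 : u ≤ 1 / 30 := by rw [hu]; exact one_div_le_one_div_of_le (by norm_num) ha30
  have hv1 : u^2 ≤ 1/900 := by nlinarith
  have hu3 : u^3 ≤ u/900 := by nlinarith
  have hu3p : 0 < u^3 := by positivity
  let G : ℝ → ℝ := fun t => 2 * (a-t)^3 * Real.cos t - (a-t)^2*((a-t)^2-3) * Real.sin t
    - Real.sin t ^ 3
  have hG : Continuous G := by fun_prop
  have hlow : 0 ≤ G (2*u) := by
    have hs : Real.sin (2*u) ≤ 2*u := Real.sin_le (by linarith)
    have hs0 : 0 ≤ Real.sin (2*u) :=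
      Real.sin_nonneg_of_nonneg_of_le_pi (by linarith) (by linarith)
    have hc := Real.one_sub_sq_div_two_le_cos (x := 2*u)
    have hw : 29 ≤ a - 2*u := by linarith
    obtain ⟨w, hwd⟩ : ∃ w, w = a - 2*u := ⟨_, rfl⟩
    show 0 ≤ 2 * (a-2*u)^3 * Real.cos (2*u) - (a-2*u)^2*((a-2*u)^2-3) * Real.sin (2*u)
      - Real.sin (2*u) ^ 3
    rw [← hwd] at hw ⊢
    have h1 : 2*w^3*(1 - (2*u)^2/2) ≤ 2*w^3*Real.cos (2*u) :=
      mul_le_mul_of_nonneg_left hc (by positivity)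
    have h2 : w^2*(w^2-3) * Real.sin (2*u) ≤ w^2*(w^2-3) * (2*u) :=
      mul_le_mul_of_nonneg_left hs (mul_nonneg (by positivity) (by nlinarith))
    have h3 : Real.sin (2*u)^3 ≤ (2*u)^3 := pow_le_pow_left₀ hs0 hs 3
    have h4 : w * u = 1 - 2*u^2 := by rw [hwd]; linarith
    have h5 : 2*w^3*(1 - (2*u)^2/2) - w^2*(w^2-3) * (2*u) - (2*u)^3 = 6*w^2*u - 8*u^3 := by
      linear_combination (-2*w^3) * h4
    have h6 : 8*u^3 ≤ 6*w^2*u := by nlinarith [mul_pos hu0 hu0]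
    linarith
  have hup : G (2*u+20*u^3) ≤ 0 := by
    obtain ⟨t, ht⟩ : ∃ t, t = 2*u+20*u^3 := ⟨_, rfl⟩
    rw [← ht]
    have ht0 : 0 < t := by rw [ht]; positivity
    have ht1 : t ≤ 1 := by rw [ht]; linarith
    have hs : t - t^3/4 ≤ Real.sin t := by
      have := Real.sin_gt_sub_cube ht0
      have h3 : 0 < t^3 := by positivity
      linarith
    have hs0 : 0 ≤ Real.sin t :=
      Real.sin_nonneg_of_nonneg_of_le_pi (by linarith) (by linarith)
    have hc := Real.cos_le_one t
    show 2 * (a-t)^3 * Real.cos t - (a-t)^2*((a-t)^2-3) * Real.sin t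
      - Real.sin t ^ 3 ≤ 0
    have hw : 29 ≤ a - t := by linarith
    obtain ⟨w, hwd⟩ : ∃ w, w = a - t := ⟨_, rfl⟩
    rw [← hwd] at hw ⊢
    have h1 : 2*w^3*Real.cos t ≤ 2*w^3*1 :=
      mul_le_mul_of_nonneg_left hc (by positivity)
    have h2 : w^2*(w^2-3) * (t - t^3/4) ≤ w^2*(w^2-3) * Real.sin t :=
      mul_le_mul_of_nonneg_left hs (mul_nonneg (by positivity) (by nlinarith))
    have h3 : 0 ≤ Real.sin t^3 := by positivity
    have h4 : w * u = 1 - 2*u^2 - 20*(u^2)^2 := by rw [hwd, ht]; linarith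
    have h5 := aux_upper (u^2) (by positivity) hv1
    rw [← h4] at h5
    have h6 : ((w*u)^2 - 3*u^2) * ((2 + 20*u^2) * (1 - u^2*(1+10*u^2)^2))
        = u * ((w^2-3) * (t - t^3/4)) := by rw [ht]; ring
    rw [h6] at h5
    have h7 : 2*w ≤ (w^2-3) * (t - t^3/4) := by
      refine le_of_mul_le_mul_left ?_ hu0
      linarith
    have h8 := mul_le_mul_of_nonneg_left h7 (sq_nonneg w)
    linarith
  obtain ⟨t, ⟨ht1, ht2⟩, hGt⟩ := intermediate_value_Icc' (by linarith : 2*u ≤ 2*u+20*u^3)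
    hG.continuousOn ⟨hup, hlow⟩
  have hGt' : 2 * (a-t)^3 * Real.cos t - (a-t)^2*((a-t)^2-3) * Real.sin t
      - Real.sin t ^ 3 = 0 := hGt
  refine ⟨a - t, ?_, ?_⟩
  · have hc : Real.cos (a - t) = (-1)^k * Real.cos t := by
      rw [ha, Real.cos_nat_mul_pi_sub]
    have hs : Real.sin (a - t) = -((-1)^k * Real.sin t) := by
      rw [ha, Real.sin_nat_mul_pi_sub]
    rw [hc, hs]
    rcases neg_one_pow_eq_or ℝ k with h | h <;> rw [h] <;> linarith
  · rw [← ha]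
    have e : 2 / a = 2*u := by rw [hu]; ring
    have e3 : 20*u^3 ≤ 20 / (k:ℝ)^3 := by
      have : 20*u^3 = 20 / a^3 := by rw [hu]; ring
      rw [this]
      gcongr
    rw [e, abs_le]
    constructor <;> linarith
end
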